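/- arXiv:1808.00387 — 2 statements merged into one kernel-verified Lean document; each statement's English description precedes it below -/
import Mathlib

section
/- Let Z_1,…,Z_n be i.i.d. random vectors in ℝ^d whose entries are i.i.d. with mean 0, variance 1, and |Z_i(k)| ≤ C·d^{2/(8+m)} for some m > 0, and suppose c ≤ d/n ≤ C' for universal constants c, C' > 0. Let Σ be a positive semidefinite d×d matrix with ‖Σ‖_op ≤ 1 and set θ = 1/2 − 2/(8+m). Then for all d large enough, with probability at least 1 − d^{−2}, max_{1 ≤ i,j ≤ n} | Z_i^T Σ Z_j / d − δ_{ij} Tr(Σ)/d | ≤ d^{−θ} log^{0.51} d, where δ_{ij} is the Kronecker delta. -/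
open MeasureTheory Matrix Finset

/-- Operator (spectral) norm of a real matrix. -/
noncomputable def opNorm {m n : ℕ} (A : Matrix (Fin m) (Fin n) ℝ) : ℝ :=
  ‖LinearMap.toContinuousLinearMap (Matrix.toEuclideanLin A)‖

/-- A law of mean `0` and second moment `1` supported in `[-K, K]`. -/
structure IsBoundedStandardized (ρ : Measure ℝ) (K : ℝ) : Prop where
  integrable_sq : Integrable (fun t : ℝ => t ^ 2) ρ
  mean : ∫ t, t ∂ρ = 0
  second_moment : ∫ t, t ^ 2 ∂ρ = 1
  bound : ∀ᵐ t ∂ρ, |t| ≤ K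

namespace IsBoundedStandardized

variable {ρ : Measure ℝ} [IsProbabilityMeasure ρ] {K : ℝ}

lemma bound_nonneg (h : IsBoundedStandardized ρ K) : 0 ≤ K := by
  obtain ⟨t, ht⟩ := h.bound.exists
  exact (abs_nonneg t).trans ht

lemma one_le_bound_sq (h : IsBoundedStandardized ρ K) : 1 ≤ K ^ 2 := by
  calc (1 : ℝ) = ∫ t, t ^ 2 ∂ρ := h.second_moment.symm
    _ ≤ ∫ _, K ^ 2 ∂ρ := by
        refine integral_mono_ae h.integrable_sq (integrable_const _) ?_
        filter_upwards [h.bound] with t ht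
        exact sq_le_sq' (abs_le.1 ht).1 (abs_le.1 ht).2
    _ = K ^ 2 := by simp

lemma lintegral_exp_mul_le (h : IsBoundedStandardized ρ K) (a : ℝ) :
    ∫⁻ t, ENNReal.ofReal (Real.exp (a * t)) ∂ρ ≤
      ENNReal.ofReal (Real.exp (a ^ 2 * K ^ 2 / 2)) := by
  have hb : ∀ᵐ t ∂ρ, t ∈ Set.Icc (-K) K := by
    filter_upwards [h.bound] with t ht using abs_le.1 ht
  have hs := ProbabilityTheory.hasSubgaussianMGF_of_mem_Icc_of_integral_eq_zero
    (X := fun t => t) aemeasurable_id hb h.mean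
  have hle := hs.mgf_le a
  rw [ProbabilityTheory.mgf] at hle
  rw [← ofReal_integral_eq_lintegral_ofReal (hs.integrable_exp_mul a)
    (Filter.Eventually.of_forall fun t => (Real.exp_pos _).le)]
  refine ENNReal.ofReal_le_ofReal (hle.trans_eq ?_)
  congr 1
  have h2 : |K - -K| = 2 * K := by
    rw [abs_of_nonneg] <;> linarith [h.bound_nonneg]
  push_cast
  rw [Real.norm_eq_abs, h2]
  ring

lemma lintegral_exp_le_of_quadratic (h : IsBoundedStandardized ρ K) {f : ℝ → ℝ} {a b : ℝ}
    (hf : ∀ᵐ t ∂ρ, Real.exp (f t) ≤ a + b * t ^ 2) :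
    ∫⁻ t, ENNReal.ofReal (Real.exp (f t)) ∂ρ ≤ ENNReal.ofReal (Real.exp (a + b - 1)) := by
  have hi : Integrable (fun t : ℝ => a + b * t ^ 2) ρ :=
    (integrable_const a).add (h.integrable_sq.const_mul b)
  calc ∫⁻ t, ENNReal.ofReal (Real.exp (f t)) ∂ρ
      ≤ ∫⁻ t, ENNReal.ofReal (a + b * t ^ 2) ∂ρ := by
        refine lintegral_mono_ae ?_
        filter_upwards [hf] with t ht using ENNReal.ofReal_le_ofReal ht
    _ = ENNReal.ofReal (∫ t, a + b * t ^ 2 ∂ρ) := by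
        refine (ofReal_integral_eq_lintegral_ofReal hi ?_).symm
        filter_upwards [hf] with t ht using (Real.exp_pos _).le.trans ht
    _ ≤ ENNReal.ofReal (Real.exp (a + b - 1)) := by
        refine ENNReal.ofReal_le_ofReal ?_
        rw [integral_add (integrable_const a) (h.integrable_sq.const_mul b),
          integral_const_mul, h.second_moment]
        simp only [integral_const, probReal_univ, one_smul, mul_one]
        linarith [Real.add_one_le_exp (a + b - 1)]

lemma lintegral_exp_mul_sq_le (h : IsBoundedStandardized ρ K) {s : ℝ} (hs : 0 ≤ s)
    (hsK : s * K ^ 2 ≤ 1) :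
    ∫⁻ t, ENNReal.ofReal (Real.exp (s * t ^ 2)) ∂ρ ≤ ENNReal.ofReal (Real.exp (2 * s)) := by
  have := h.lintegral_exp_le_of_quadratic (f := fun t => s * t ^ 2) (a := 1) (b := 2 * s) ?_
  · simpa using this
  filter_upwards [h.bound] with t ht
  have ht2 : t ^ 2 ≤ K ^ 2 := sq_le_sq' (abs_le.1 ht).1 (abs_le.1 ht).2
  have h0 : 0 ≤ s * t ^ 2 := by positivity
  have h1 : s * t ^ 2 ≤ 1 := (mul_le_mul_of_nonneg_left ht2 hs).trans hsK
  have := (abs_le.1 (Real.abs_exp_sub_one_sub_id_le (abs_le.2 ⟨by linarith, h1⟩))).2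
  nlinarith

lemma lintegral_exp_mul_sq_sub_one_le (h : IsBoundedStandardized ρ K) {a : ℝ}
    (haK : |a| * K ^ 2 ≤ 1) :
    ∫⁻ t, ENNReal.ofReal (Real.exp (a * (t ^ 2 - 1))) ∂ρ ≤
      ENNReal.ofReal (Real.exp (a ^ 2 * K ^ 2)) := by
  have := h.lintegral_exp_le_of_quadratic (f := fun t => a * (t ^ 2 - 1))
    (a := 1 - a + a ^ 2) (b := a + a ^ 2 * (K ^ 2 - 2)) ?_
  · refine this.trans (ENNReal.ofReal_le_ofReal (Real.exp_le_exp.2 ?_))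
    nlinarith [sq_nonneg a]
  filter_upwards [h.bound] with t ht
  have ht2 : t ^ 2 ≤ K ^ 2 := sq_le_sq' (abs_le.1 ht).1 (abs_le.1 ht).2
  have h1 : |t ^ 2 - 1| ≤ K ^ 2 :=
    abs_le.2 ⟨by nlinarith [h.one_le_bound_sq, sq_nonneg t], by linarith⟩
  have h2 : |a * (t ^ 2 - 1)| ≤ 1 := by
    rw [abs_mul]
    exact (mul_le_mul_of_nonneg_left h1 (abs_nonneg a)).trans haK
  have h3 := (abs_le.1 (Real.abs_exp_sub_one_sub_id_le h2)).2
  have h4 : a ^ 2 * (t ^ 2 * t ^ 2) ≤ a ^ 2 * (K ^ 2 * t ^ 2) := by gcongr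
  nlinarith

end IsBoundedStandardized

lemma lintegral_pi_exp_sum_le {ι : Type*} [Fintype ι] {ρ : Measure ℝ} [IsProbabilityMeasure ρ]
    {f : ι → ℝ → ℝ} {b : ι → ℝ} (hf : ∀ i, Measurable (f i))
    (hb : ∀ i, ∫⁻ t, ENNReal.ofReal (Real.exp (f i t)) ∂ρ ≤ ENNReal.ofReal (Real.exp (b i))) :
    ∫⁻ x, ENNReal.ofReal (Real.exp (∑ i, f i (x i))) ∂(Measure.pi fun _ : ι => ρ) ≤
      ENNReal.ofReal (Real.exp (∑ i, b i)) := by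
  have hm : ∀ i, Measurable fun t => ENNReal.ofReal (Real.exp (f i t)) := fun i =>
    ((hf i).exp).ennreal_ofReal
  simp_rw [Real.exp_sum, ENNReal.ofReal_prod_of_nonneg fun i _ => (Real.exp_pos _).le]
  rw [ProbabilityTheory.lintegral_prod_eq_prod_lintegral_of_indepFun univ
    (fun i (x : ι → ℝ) => ENNReal.ofReal (Real.exp (f i (x i))))
    (ProbabilityTheory.iIndepFun_pi fun i => (hm i).aemeasurable)
    fun i => (hm i).comp (measurable_pi_apply i)]
  refine Finset.prod_le_prod' fun i _ => ?_
  rw [(measurePreserving_eval (fun _ : ι => ρ) i).lintegral_comp (hm i)]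
  exact hb i

lemma lintegral_exp_sum_mul_le {Ω ι : Type*} [MeasurableSpace Ω] {μ : Measure Ω} [Fintype ι]
    {w : ι → ℝ} (hw : ∀ i, 0 ≤ w i) (hw1 : ∑ i, w i = 1) {f : ι → Ω → ℝ} {B : ℝ}
    (hf : ∀ i, Measurable (f i))
    (hB : ∀ i, ∫⁻ ω, ENNReal.ofReal (Real.exp (f i ω)) ∂μ ≤ ENNReal.ofReal (Real.exp B)) :
    ∫⁻ ω, ENNReal.ofReal (Real.exp (∑ i, w i * f i ω)) ∂μ ≤ ENNReal.ofReal (Real.exp B) := by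
  have hm : ∀ i, Measurable fun ω => ENNReal.ofReal (Real.exp (f i ω)) := fun i =>
    ((hf i).exp).ennreal_ofReal
  calc ∫⁻ ω, ENNReal.ofReal (Real.exp (∑ i, w i * f i ω)) ∂μ
      ≤ ∫⁻ ω, ∑ i, ENNReal.ofReal (w i) * ENNReal.ofReal (Real.exp (f i ω)) ∂μ := by
        refine lintegral_mono fun ω => ?_
        have hJ := convexOn_exp.map_sum_le (t := univ) (w := w) (p := fun i => f i ω)
          (fun i _ => hw i) hw1 (fun i _ => Set.mem_univ _)
        simp only [smul_eq_mul] at hJ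
        refine (ENNReal.ofReal_le_ofReal hJ).trans_eq ?_
        rw [ENNReal.ofReal_sum_of_nonneg fun i _ => mul_nonneg (hw i) (Real.exp_pos _).le]
        exact Finset.sum_congr rfl fun i _ => ENNReal.ofReal_mul (hw i)
    _ = ∑ i, ENNReal.ofReal (w i) * ∫⁻ ω, ENNReal.ofReal (Real.exp (f i ω)) ∂μ := by
        rw [lintegral_finsetSum _ fun i _ => (hm i).const_mul _]
        exact Finset.sum_congr rfl fun i _ => lintegral_const_mul _ (hm i)
    _ ≤ ∑ i, ENNReal.ofReal (w i) * ENNReal.ofReal (Real.exp B) := by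
        gcongr with i
        exact hB i
    _ = ENNReal.ofReal (Real.exp B) := by
        rw [← Finset.sum_mul, ← ENNReal.ofReal_sum_of_nonneg fun i _ => hw i, hw1]
        simp

/-- A matrix whose `ℓ²` operator norm is at most `1`. -/
def IsL2Contraction {ι κ : Type*} [Fintype ι] [Fintype κ] (A : Matrix ι κ ℝ) : Prop :=
  ∀ y : κ → ℝ, ∑ i, (A *ᵥ y) i ^ 2 ≤ ∑ k, y k ^ 2

namespace IsL2Contraction

variable {ι κ : Type*} [Fintype ι] [Fintype κ]

lemma submatrix_subtype {A : Matrix ι κ ℝ} (hA : IsL2Contraction A) (p : ι → Prop) (q : κ → Prop)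
    [Fintype (Subtype p)] [Fintype (Subtype q)] :
    IsL2Contraction (A.submatrix (Subtype.val : Subtype p → ι) (Subtype.val : Subtype q → κ)) := by
  classical
  intro y
  let z : κ → ℝ := fun k => if h : q k then y ⟨k, h⟩ else 0
  have hz : ∀ k : Subtype q, z k = y k := fun k => dif_pos k.2
  have hsum : ∀ g : κ → ℝ, (∀ k, ¬ q k → g k = 0) → ∑ k, g k = ∑ k : Subtype q, g k := by
    intro g hg
    rw [← Finset.sum_subtype (univ.filter q) (by simp) g, Finset.sum_filter]
    refine Finset.sum_congr rfl fun k _ => ?_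
    split_ifs with h
    · rfl
    · exact hg k h
  have hmul : ∀ i : Subtype p, (A.submatrix (Subtype.val : Subtype p → ι)
      (Subtype.val : Subtype q → κ) *ᵥ y) i = (A *ᵥ z) i := by
    intro i
    simp only [mulVec, dotProduct, submatrix_apply]
    rw [hsum _ fun k hk => by simp [z, hk]]
    simp_rw [hz]
  calc ∑ i : Subtype p, _ ^ 2 = ∑ i : Subtype p, (A *ᵥ z) i ^ 2 := by simp_rw [hmul]
    _ = ∑ i ∈ univ.filter p, (A *ᵥ z) i ^ 2 :=
        (Finset.sum_subtype (univ.filter p) (by simp) fun i => (A *ᵥ z) i ^ 2).symm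
    _ ≤ ∑ i, (A *ᵥ z) i ^ 2 :=
        Finset.sum_le_sum_of_subset_of_nonneg (filter_subset _ _) fun _ _ _ => sq_nonneg _
    _ ≤ ∑ k, z k ^ 2 := hA z
    _ = ∑ k : Subtype q, y k ^ 2 := by
        rw [hsum _ fun k hk => by simp [z, hk]]
        simp_rw [hz]

lemma abs_diag_le [DecidableEq ι] {A : Matrix ι ι ℝ} (hA : IsL2Contraction A) (i : ι) :
    |A i i| ≤ 1 := by
  have h := hA (Pi.single i 1)
  have h1 : ∑ k, (Pi.single i (1 : ℝ) : ι → ℝ) k ^ 2 = 1 := by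
    simp [Pi.single_apply, ite_pow]
  rw [h1] at h
  rw [← sq_le_one_iff_abs_le_one]
  refine le_trans ?_ h
  refine le_trans ?_ (Finset.single_le_sum (fun k _ => sq_nonneg _) (mem_univ i))
  simp

end IsL2Contraction

lemma isL2Contraction_of_opNorm_le {d e : ℕ} {A : Matrix (Fin d) (Fin e) ℝ} (hA : opNorm A ≤ 1) :
    IsL2Contraction A := by
  intro y
  have h := ContinuousLinearMap.le_of_opNorm_le _ hA (WithLp.toLp 2 y)
  rw [one_mul] at h
  have h2 := pow_le_pow_left₀ (norm_nonneg _) h 2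
  rw [EuclideanSpace.real_norm_sq_eq, EuclideanSpace.real_norm_sq_eq] at h2
  simpa using h2

lemma lintegral_exp_bilinear_le {ι κ : Type*} [Fintype ι] [Fintype κ] {ρ : Measure ℝ}
    [IsProbabilityMeasure ρ] {K : ℝ} (hρ : IsBoundedStandardized ρ K) {A : Matrix ι κ ℝ}
    (hA : IsL2Contraction A) {a : ℝ} (ha : a ^ 2 * K ^ 4 ≤ 2) :
    ∫⁻ p, ENNReal.ofReal (Real.exp (a * (p.1 ⬝ᵥ A *ᵥ p.2)))
      ∂((Measure.pi fun _ : ι => ρ).prod (Measure.pi fun _ : κ => ρ)) ≤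
      ENNReal.ofReal (Real.exp (a ^ 2 * K ^ 2 * Fintype.card κ)) := by
  have hm : Measurable fun p : (ι → ℝ) × (κ → ℝ) =>
      ENNReal.ofReal (Real.exp (a * (p.1 ⬝ᵥ A *ᵥ p.2))) := by
    simp only [mulVec, dotProduct]
    fun_prop
  rw [lintegral_prod_symm' _ hm]
  have hin : ∀ y : κ → ℝ, ∫⁻ x, ENNReal.ofReal (Real.exp (a * (x ⬝ᵥ A *ᵥ y)))
      ∂(Measure.pi fun _ : ι => ρ) ≤
      ENNReal.ofReal (Real.exp (∑ k, a ^ 2 * K ^ 2 / 2 * y k ^ 2)) := by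
    intro y
    have h := lintegral_pi_exp_sum_le (ρ := ρ) (f := fun i t => (a * (A *ᵥ y) i) * t)
      (fun i => measurable_const_mul _) fun i => hρ.lintegral_exp_mul_le _
    calc _ = _ := by
          refine lintegral_congr fun x => ?_
          congr 2
          rw [dotProduct, Finset.mul_sum]
          exact Finset.sum_congr rfl fun i _ => by ring
      _ ≤ _ := h
      _ ≤ _ := by
          refine ENNReal.ofReal_le_ofReal (Real.exp_le_exp.2 ?_)
          calc ∑ i, (a * (A *ᵥ y) i) ^ 2 * K ^ 2 / 2
              = a ^ 2 * K ^ 2 / 2 * ∑ i, (A *ᵥ y) i ^ 2 := by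
                rw [Finset.mul_sum]
                exact Finset.sum_congr rfl fun i _ => by ring
            _ ≤ a ^ 2 * K ^ 2 / 2 * ∑ k, y k ^ 2 := by
                gcongr
                exact hA y
            _ = _ := Finset.mul_sum _ _ _
  refine (lintegral_mono hin).trans ?_
  refine (lintegral_pi_exp_sum_le (ρ := ρ) (f := fun _ t => a ^ 2 * K ^ 2 / 2 * t ^ 2)
    (fun i => by fun_prop) fun i => hρ.lintegral_exp_mul_sq_le (by positivity)
      (by nlinarith)).trans_eq ?_
  congr 2
  simp only [sum_const, card_univ, nsmul_eq_mul]
  ring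

lemma four_mul_sum_ite_mem_and_notMem {ι : Type*} [Fintype ι] [DecidableEq ι] {k l : ι}
    (hkl : k ≠ l) :
    4 * ∑ I : Finset ι, (if k ∈ I ∧ l ∉ I then (1 : ℝ) else 0) = 2 ^ Fintype.card ι := by
  have hinv : ∀ J : Finset ι, Function.Involutive fun I : Finset ι => symmDiff I J :=
    fun J I => symmDiff_symmDiff_cancel_right J I
  have toggle : ∀ (J : Finset ι) (g : Finset ι → ℝ), ∑ I, g I = ∑ I, g (symmDiff I J) :=
    fun J g => ((hinv J).toPerm.sum_comp univ g (by simp)).symm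
  set g : Finset ι → ℝ := fun I => if k ∈ I ∧ l ∉ I then (1 : ℝ) else 0 with hg
  calc 4 * ∑ I, g I = ∑ I, g I + ∑ I, g (symmDiff I {k}) + ∑ I, g (symmDiff I {l})
        + ∑ I, g (symmDiff I {k, l}) := by
        rw [← toggle, ← toggle, ← toggle]
        ring
    _ = ∑ I : Finset ι, 1 := by
        simp_rw [← Finset.sum_add_distrib]
        refine Finset.sum_congr rfl fun I _ => ?_
        by_cases h1 : k ∈ I <;> by_cases h2 : l ∈ I <;>
          simp [hg, mem_symmDiff, h1, h2, hkl, hkl.symm]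
    _ = 2 ^ Fintype.card ι := by simp

lemma sum_sum_offDiag_eq_sum_finset {ι : Type*} [Fintype ι] [DecidableEq ι] (b : ι → ι → ℝ) :
    ∑ k, ∑ l, (if k = l then 0 else b k l) =
      ∑ I : Finset ι, (2 ^ Fintype.card ι : ℝ)⁻¹ *
        (4 * ∑ k, ∑ l, if k ∈ I ∧ l ∉ I then b k l else 0) := by
  have h2 : (2 ^ Fintype.card ι : ℝ) ≠ 0 := by positivity
  rw [← Finset.mul_sum, ← Finset.mul_sum, eq_inv_mul_iff_mul_eq₀ h2]
  conv_rhs => rw [Finset.sum_comm]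
  rw [Finset.mul_sum, Finset.mul_sum]
  refine Finset.sum_congr rfl fun k _ => ?_
  conv_rhs => rw [Finset.sum_comm]
  rw [Finset.mul_sum, Finset.mul_sum]
  refine Finset.sum_congr rfl fun l _ => ?_
  split_ifs with hkl
  · subst hkl
    simp
  · rw [← four_mul_sum_ite_mem_and_notMem hkl, mul_assoc, Finset.sum_mul]
    simp

lemma lintegral_exp_offDiag_le {ι : Type*} [Fintype ι] [DecidableEq ι] {ρ : Measure ℝ}
    [IsProbabilityMeasure ρ] {K : ℝ} (hρ : IsBoundedStandardized ρ K) {A : Matrix ι ι ℝ}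
    (hA : IsL2Contraction A) {a : ℝ} (ha : 16 * a ^ 2 * K ^ 4 ≤ 2) :
    ∫⁻ x, ENNReal.ofReal (Real.exp
      (a * ∑ k, ∑ l, (if k = l then 0 else x k * A k l * x l))) ∂(Measure.pi fun _ : ι => ρ) ≤
      ENNReal.ofReal (Real.exp (16 * a ^ 2 * K ^ 2 * Fintype.card ι)) := by
  have hsplit : ∀ x : ι → ℝ, a * ∑ k, ∑ l, (if k = l then 0 else x k * A k l * x l) =
      ∑ I : Finset ι, (2 ^ Fintype.card ι : ℝ)⁻¹ *
        ((4 * a) * ∑ k, ∑ l, if k ∈ I ∧ l ∉ I then x k * A k l * x l else 0) := by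
    intro x
    rw [sum_sum_offDiag_eq_sum_finset, Finset.mul_sum]
    exact Finset.sum_congr rfl fun I _ => by ring
  simp_rw [hsplit]
  refine lintegral_exp_sum_mul_le (fun _ => by positivity) (by simp) (fun I => ?_) fun I => ?_
  · refine Measurable.const_mul (Finset.measurable_fun_sum _ fun k _ =>
      Finset.measurable_fun_sum _ fun l _ => ?_) _
    split_ifs <;> fun_prop
  obtain ⟨p, hp⟩ : ∃ p : ι → Prop, ∀ k, k ∈ I ↔ p k := ⟨(· ∈ I), fun _ => Iff.rfl⟩
  classical
  simp_rw [hp]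
  let e := MeasurableEquiv.piEquivPiSubtypeProd (fun _ : ι => ℝ) p
  have he : MeasurePreserving e _ _ :=
    measurePreserving_piEquivPiSubtypeProd (fun _ : ι => ρ) p
  let B := A.submatrix (Subtype.val : {k // p k} → ι) (Subtype.val : {l // ¬ p l} → ι)
  have hB : IsL2Contraction B := hA.submatrix_subtype p (¬ p ·)
  have hx : ∀ x : ι → ℝ, (∑ k, ∑ l, if p k ∧ ¬ p l then x k * A k l * x l else 0) =
      (e x).1 ⬝ᵥ B *ᵥ (e x).2 := by
    intro x
    have h1 : (e x).1 ⬝ᵥ B *ᵥ (e x).2 =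
        ∑ k : {k // p k}, ∑ l : {l // ¬ p l}, x k * A k l * x l := by
      simp only [mulVec, dotProduct, Finset.mul_sum, mul_assoc]
      rfl
    rw [h1, ← Finset.sum_subtype (univ.filter p) (by simp)
      fun k => ∑ l : {l // ¬ p l}, x k * A k l * x l, Finset.sum_filter]
    refine Finset.sum_congr rfl fun k _ => ?_
    rw [← Finset.sum_subtype (univ.filter (¬ p ·)) (by simp) fun l => x k * A k l * x l,
      Finset.sum_filter]
    by_cases hk : p k <;> simp [hk]
  simp_rw [hx]
  have hm : Measurable fun p : ({k // p k} → ℝ) × ({l // ¬ p l} → ℝ) =>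
      ENNReal.ofReal (Real.exp (4 * a * (p.1 ⬝ᵥ B *ᵥ p.2))) := by
    simp only [mulVec, dotProduct]
    fun_prop
  rw [he.lintegral_comp hm]
  refine (lintegral_exp_bilinear_le hρ hB (a := 4 * a) (by linarith)).trans
    (ENNReal.ofReal_le_ofReal (Real.exp_le_exp.2 ?_))
  have hc : (Fintype.card {l // ¬ p l} : ℝ) ≤ Fintype.card ι := by
    exact_mod_cast Fintype.card_subtype_le _
  calc (4 * a) ^ 2 * K ^ 2 * Fintype.card {l // ¬ p l}
      ≤ (4 * a) ^ 2 * K ^ 2 * Fintype.card ι := by gcongr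
    _ = _ := by ring

lemma lintegral_exp_quadratic_sub_trace_le {ι : Type*} [Fintype ι] [DecidableEq ι]
    {ρ : Measure ℝ} [IsProbabilityMeasure ρ] {K : ℝ} (hρ : IsBoundedStandardized ρ K)
    {A : Matrix ι ι ℝ} (hA : IsL2Contraction A) {a : ℝ} (ha : |a| * K ^ 2 ≤ 1 / 6) :
    ∫⁻ x, ENNReal.ofReal (Real.exp (a * (x ⬝ᵥ A *ᵥ x - A.trace)))
      ∂(Measure.pi fun _ : ι => ρ) ≤
      ENNReal.ofReal (Real.exp (64 * a ^ 2 * K ^ 2 * Fintype.card ι)) := by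
  let f : Bool → (ι → ℝ) → ℝ := fun b x =>
    if b then (2 * a) * ∑ k, ∑ l, (if k = l then 0 else x k * A k l * x l)
    else ∑ k, 2 * a * A k k * (x k ^ 2 - 1)
  have hf : ∀ x : ι → ℝ, a * (x ⬝ᵥ A *ᵥ x - A.trace) = ∑ b, (1 / 2 : ℝ) * f b x := by
    intro x
    have h1 : x ⬝ᵥ A *ᵥ x - A.trace = ∑ k, A k k * (x k ^ 2 - 1) +
        ∑ k, ∑ l, (if k = l then 0 else x k * A k l * x l) := by
      simp only [dotProduct, mulVec, Matrix.trace, diag_apply, ← Finset.sum_sub_distrib,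
        ← Finset.sum_add_distrib, Finset.mul_sum]
      refine Finset.sum_congr rfl fun k _ => ?_
      rw [← Finset.add_sum_erase _ _ (mem_univ k),
        ← Finset.add_sum_erase _ (fun l => if k = l then 0 else x k * A k l * x l) (mem_univ k)]
      have h2 : ∑ l ∈ univ.erase k, (if k = l then 0 else x k * A k l * x l) =
          ∑ l ∈ univ.erase k, x k * (A k l * x l) := by
        refine Finset.sum_congr rfl fun l hl => ?_
        rw [if_neg (ne_of_mem_erase hl).symm, mul_assoc]
      rw [h2, if_pos rfl]
      ring
    rw [h1]
    simp only [Fintype.univ_bool, mem_singleton, Bool.true_eq_false, not_false_eq_true,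
      sum_insert, sum_singleton, f, if_true, Bool.false_eq_true, if_false]
    have h3 : ∑ k, 2 * a * A k k * (x k ^ 2 - 1) = 2 * a * ∑ k, A k k * (x k ^ 2 - 1) := by
      rw [Finset.mul_sum]
      exact Finset.sum_congr rfl fun k _ => by ring
    rw [h3]
    ring
  have haK : a ^ 2 * K ^ 4 ≤ 1 / 36 := by
    have h := pow_le_pow_left₀ (by positivity) ha 2
    rw [mul_pow, sq_abs] at h
    linarith
  simp_rw [hf]
  refine lintegral_exp_sum_mul_le (fun _ => by norm_num) (by simp) (fun b => ?_) fun b => ?_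
  · cases b
    · simp only [f, Bool.false_eq_true, if_false]
      fun_prop
    · simp only [f, if_true]
      refine Measurable.const_mul (Finset.measurable_fun_sum _ fun k _ =>
        Finset.measurable_fun_sum _ fun l _ => ?_) _
      split_ifs <;> fun_prop
  cases b
  · simp only [f, Bool.false_eq_true, if_false]
    have hd : ∀ k, (A k k) ^ 2 ≤ 1 := fun k => (sq_le_one_iff_abs_le_one _).2 (hA.abs_diag_le k)
    refine (lintegral_pi_exp_sum_le (ρ := ρ) (f := fun k t => 2 * a * A k k * (t ^ 2 - 1))
      (fun k => by fun_prop) fun k => hρ.lintegral_exp_mul_sq_sub_one_le ?_).trans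
      (ENNReal.ofReal_le_ofReal (Real.exp_le_exp.2 ?_))
    · rw [abs_mul, abs_mul, abs_two]
      have h1 := mul_le_mul_of_nonneg_left (hA.abs_diag_le k)
        (show 0 ≤ |a| * K ^ 2 by positivity)
      linarith
    · calc ∑ k, (2 * a * A k k) ^ 2 * K ^ 2 ≤ ∑ _k : ι, 64 * a ^ 2 * K ^ 2 := by
            refine Finset.sum_le_sum fun k _ => ?_
            have h1 := mul_le_mul_of_nonneg_left (hd k) (show 0 ≤ a ^ 2 * K ^ 2 by positivity)
            have h2 : 0 ≤ a ^ 2 * K ^ 2 := by positivity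
            nlinarith
        _ = _ := by
            simp only [sum_const, card_univ, nsmul_eq_mul]
            ring
  · simp only [f, if_true]
    refine (lintegral_exp_offDiag_le hρ hA (a := 2 * a) (by linarith)).trans_eq ?_
    congr 2
    ring

lemma measure_ge_le_of_lintegral_exp_le {Ω : Type*} [MeasurableSpace Ω] {μ : Measure Ω}
    {X : Ω → ℝ} (hX : Measurable X) {B : ℝ}
    (h : ∫⁻ ω, ENNReal.ofReal (Real.exp (X ω)) ∂μ ≤ ENNReal.ofReal (Real.exp B)) (s : ℝ) :
    μ {ω | s ≤ X ω} ≤ ENNReal.ofReal (Real.exp (B - s)) := by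
  have hM := (mul_meas_ge_le_lintegral (μ := μ) hX.exp.ennreal_ofReal
    (ENNReal.ofReal (Real.exp s))).trans h
  have hset : {ω | s ≤ X ω} =
      {ω | ENNReal.ofReal (Real.exp s) ≤ ENNReal.ofReal (Real.exp (X ω))} := by
    ext ω
    simp [ENNReal.ofReal_le_ofReal_iff (Real.exp_pos _).le]
  rw [hset, Real.exp_sub, ENNReal.ofReal_div_of_pos (Real.exp_pos s)]
  rw [ENNReal.le_div_iff_mul_le (Or.inl (by simp [Real.exp_pos])) (Or.inl ENNReal.ofReal_ne_top),
    mul_comm]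
  exact hM

lemma measure_lt_abs_le_of_lintegral_exp_le {Ω : Type*} [MeasurableSpace Ω] {μ : Measure Ω}
    {X : Ω → ℝ} (hX : Measurable X) {V L t : ℝ} (hV : 0 < V) (ht : 0 ≤ t) (htL : t ≤ 2 * V * L)
    (h : ∀ a : ℝ, |a| ≤ L →
      ∫⁻ ω, ENNReal.ofReal (Real.exp (a * X ω)) ∂μ ≤ ENNReal.ofReal (Real.exp (V * a ^ 2))) :
    μ {ω | t < |X ω|} ≤ 2 * ENNReal.ofReal (Real.exp (-(t ^ 2 / (4 * V)))) := by
  set a := t / (2 * V) with ha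
  have ha0 : 0 ≤ a := by positivity
  have haL : |a| ≤ L := by
    rw [abs_of_nonneg ha0, ha, div_le_iff₀ (by positivity)]
    linarith
  have hexp : V * a ^ 2 - a * t = -(t ^ 2 / (4 * V)) := by
    rw [ha]
    field_simp
    ring
  have h1 := measure_ge_le_of_lintegral_exp_le (hX.const_mul a) (h a haL) (a * t)
  have h2 := measure_ge_le_of_lintegral_exp_le (hX.const_mul (-a))
    (h (-a) (by rwa [abs_neg])) (a * t)
  rw [neg_sq] at h2
  rw [hexp] at h1 h2
  calc μ {ω | t < |X ω|} ≤ μ ({ω | a * t ≤ a * X ω} ∪ {ω | a * t ≤ -a * X ω}) := by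
        refine measure_mono fun ω hω => ?_
        rcases lt_abs.1 (show t < |X ω| from hω) with hpos | hneg
        · exact Or.inl (mul_le_mul_of_nonneg_left hpos.le ha0)
        · refine Or.inr (show a * t ≤ -a * X ω from ?_)
          have := mul_le_mul_of_nonneg_left hneg.le ha0
          linarith
    _ ≤ _ := (measure_union_le _ _).trans ((add_le_add h1 h2).trans_eq (two_mul _).symm)

lemma measurePreserving_eval_prodMk_eval {ι Ω : Type*} [Fintype ι] [MeasurableSpace Ω]
    (ν : Measure Ω) [IsProbabilityMeasure ν] {i j : ι} (hij : i ≠ j) :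
    MeasurePreserving (fun Z : ι → Ω => (Z i, Z j)) (Measure.pi fun _ => ν) (ν.prod ν) := by
  refine ⟨by fun_prop, ?_⟩
  have hind := (ProbabilityTheory.iIndepFun_pi (μ := fun _ : ι => ν) (X := fun _ ω => ω)
    fun _ => aemeasurable_id).indepFun hij
  rw [(ProbabilityTheory.indepFun_iff_map_prod_eq_prod_map_map
    (measurable_pi_apply i).aemeasurable (measurable_pi_apply j).aemeasurable).1 hind]
  congr 1
  · exact (measurePreserving_eval (fun _ : ι => ν) i).map_eq
  · exact (measurePreserving_eval (fun _ : ι => ν) j).map_eq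

lemma lintegral_exp_gram_sub_trace_le {ι κ : Type*} [Fintype ι] [DecidableEq ι] [Fintype κ]
    [DecidableEq κ] {ρ : Measure ℝ} [IsProbabilityMeasure ρ] {K : ℝ}
    (hρ : IsBoundedStandardized ρ K) {A : Matrix ι ι ℝ} (hA : IsL2Contraction A) (i j : κ)
    {a : ℝ} (ha : |a| * K ^ 2 ≤ 1 / 6) :
    ∫⁻ Z : κ → ι → ℝ, ENNReal.ofReal (Real.exp
      (a * (Z i ⬝ᵥ A *ᵥ Z j - if i = j then A.trace else 0)))
      ∂(Measure.pi fun _ => Measure.pi fun _ => ρ) ≤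
      ENNReal.ofReal (Real.exp (64 * a ^ 2 * K ^ 2 * Fintype.card ι)) := by
  by_cases hij : i = j
  · subst hij
    have hm : Measurable fun x : ι → ℝ =>
        ENNReal.ofReal (Real.exp (a * (x ⬝ᵥ A *ᵥ x - A.trace))) := by
      simp only [mulVec, dotProduct]
      fun_prop
    simp only [if_true]
    rw [(measurePreserving_eval (fun _ : κ => Measure.pi fun _ : ι => ρ) i).lintegral_comp hm]
    exact lintegral_exp_quadratic_sub_trace_le hρ hA ha
  · have hm : Measurable fun p : (ι → ℝ) × (ι → ℝ) =>
        ENNReal.ofReal (Real.exp (a * (p.1 ⬝ᵥ A *ᵥ p.2))) := by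
      simp only [mulVec, dotProduct]
      fun_prop
    have haK : a ^ 2 * K ^ 4 ≤ 2 := by
      have h := pow_le_pow_left₀ (by positivity) ha 2
      rw [mul_pow, sq_abs] at h
      linarith
    simp only [hij, if_false, sub_zero]
    rw [(measurePreserving_eval_prodMk_eval (Measure.pi fun _ : ι => ρ) hij).lintegral_comp hm]
    refine (lintegral_exp_bilinear_le hρ hA haK).trans
      (ENNReal.ofReal_le_ofReal (Real.exp_le_exp.2 ?_))
    gcongr
    nlinarith [sq_nonneg a]

lemma measure_gram_deviation_le {ι κ : Type*} [Fintype ι] [DecidableEq ι] [Nonempty ι] [Fintype κ]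
    [DecidableEq κ] {ρ : Measure ℝ} [IsProbabilityMeasure ρ] {K : ℝ}
    (hρ : IsBoundedStandardized ρ K) {A : Matrix ι ι ℝ} (hA : IsL2Contraction A) (i j : κ)
    {t : ℝ} (ht0 : 0 ≤ t) (ht : t ≤ Fintype.card ι) :
    (Measure.pi fun _ : κ => Measure.pi fun _ : ι => ρ)
      {Z | t < |Z i ⬝ᵥ A *ᵥ Z j - if i = j then A.trace else 0|} ≤
      2 * ENNReal.ofReal (Real.exp (-(t ^ 2 / (256 * K ^ 2 * Fintype.card ι)))) := by
  have hK : 0 < K ^ 2 := one_pos.trans_le hρ.one_le_bound_sq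
  have hc : (0 : ℝ) < Fintype.card ι := by exact_mod_cast Fintype.card_pos
  have hX : Measurable fun Z : κ → ι → ℝ =>
      Z i ⬝ᵥ A *ᵥ Z j - if i = j then A.trace else 0 := by
    simp only [mulVec, dotProduct]
    fun_prop
  have h := measure_lt_abs_le_of_lintegral_exp_le
    (μ := Measure.pi fun _ : κ => Measure.pi fun _ : ι => ρ) hX (V := 64 * K ^ 2 * Fintype.card ι)
    (L := 1 / 6 / K ^ 2) (by positivity) ht0 ?_ fun a ha => ?_
  · refine h.trans_eq ?_
    ring_nf
  · have h1 : 2 * (64 * K ^ 2 * (Fintype.card ι : ℝ)) * (1 / 6 / K ^ 2) =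
        64 / 3 * Fintype.card ι := by
      have hK0 : K ≠ 0 := by
        rintro rfl
        simp at hK
      field_simp
      ring
    rw [h1]
    linarith
  · refine (lintegral_exp_gram_sub_trace_le hρ hA i j ((le_div_iff₀ hK).1 ha)).trans_eq ?_
    ring_nf

lemma eventually_rpow_neg_mul_log_rpow_le_one {s : ℝ} (hs : 0 < s) (r : ℝ) :
    ∀ᶠ x : ℝ in Filter.atTop, x ^ (-s) * Real.log x ^ r ≤ 1 := by
  filter_upwards [(isLittleO_log_rpow_rpow_atTop r hs).bound one_pos,
    Filter.eventually_gt_atTop 0] with x hx hx0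
  have hxs : 0 < x ^ s := Real.rpow_pos_of_pos hx0 s
  rw [Real.norm_eq_abs, Real.norm_eq_abs, abs_of_pos hxs, one_mul] at hx
  rw [Real.rpow_neg hx0.le, inv_mul_le_iff₀ hxs, mul_one]
  exact (le_abs_self _).trans hx

lemma eventually_sq_mul_exp_neg_log_rpow_le {b r : ℝ} (hb : 0 < b) (hr : 1 < r) (M : ℝ) :
    ∀ᶠ x : ℝ in Filter.atTop,
      M * x ^ 2 * Real.exp (-(Real.log x ^ r / b)) ≤ 1 / x ^ 2 := by
  have hlog : ∀ᶠ x : ℝ in Filter.atTop, b * 5 ≤ Real.log x ^ (r - 1) :=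
    ((tendsto_rpow_atTop (sub_pos.2 hr)).comp Real.tendsto_log_atTop).eventually_ge_atTop _
  filter_upwards [hlog, Filter.eventually_gt_atTop 1, Filter.eventually_ge_atTop M]
    with x hx hx1 hxM
  have hx0 : 0 < x := one_pos.trans hx1
  have hl : 0 < Real.log x := Real.log_pos hx1
  have h1 : 5 * Real.log x ≤ Real.log x ^ r / b := by
    rw [le_div_iff₀ hb, show r = (r - 1) + 1 by ring, Real.rpow_add_one hl.ne']
    nlinarith
  have h2 : Real.exp (-(Real.log x ^ r / b)) ≤ 1 / x ^ 5 := by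
    calc Real.exp (-(Real.log x ^ r / b)) ≤ Real.exp (-(5 * Real.log x)) :=
          Real.exp_le_exp.2 (neg_le_neg h1)
      _ = 1 / x ^ 5 := by
          rw [Real.exp_neg, one_div, show (5 : ℝ) = ((5 : ℕ) : ℝ) by norm_num, Real.exp_nat_mul,
            Real.exp_log hx0]
  calc M * x ^ 2 * Real.exp (-(Real.log x ^ r / b))
      ≤ x * x ^ 2 * (1 / x ^ 5) := by gcongr
    _ = 1 / x ^ 2 := by field_simp


/-- concentration of quadratic forms.  For i.i.d. random vectors
`Z_1, …, Z_n` in `ℝ^d` with i.i.d. entries of mean `0`, variance `1` and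
`|Z_i(k)| ≤ C d^{2/(8+m)}` (the entry law is `ρ`), `c ≤ d/n ≤ C'`, and any
PSD `Σ` with `‖Σ‖_op ≤ 1`, for all `d` large enough, with probability at least
`1 - d⁻²`, `max_{i,j} |Z_iᵀ Σ Z_j / d - δ_{ij} Tr(Σ)/d| ≤ d^{-θ} log^{0.51} d`
where `θ = 1/2 - 2/(8+m)`. -/
theorem stmt_4 (c C' C m : ℝ) (hc : 0 < c) (hC' : 0 < C') (hC : 0 < C) (hm : 0 < m) :
    ∃ D : ℕ, ∀ d : ℕ, D ≤ d → ∀ n : ℕ, 0 < n →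
      c ≤ (d : ℝ) / n → (d : ℝ) / n ≤ C' →
      ∀ ρ : Measure ℝ, IsProbabilityMeasure ρ →
        Integrable (fun t : ℝ => t) ρ → Integrable (fun t : ℝ => t ^ 2) ρ →
        (∫ t, t ∂ρ) = 0 → (∫ t, t ^ 2 ∂ρ) = 1 →
        (∀ᵐ t ∂ρ, |t| ≤ C * (d : ℝ) ^ ((2 : ℝ) / (8 + m))) →
        ∀ S : Matrix (Fin d) (Fin d) ℝ, S.PosSemidef → opNorm S ≤ 1 →
          ENNReal.ofReal (1 - 1 / (d : ℝ) ^ 2) ≤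
            (Measure.pi fun _ : Fin n => Measure.pi fun _ : Fin d => ρ)
              {Z : Fin n → Fin d → ℝ |
                ∀ i j : Fin n,
                  |(Z i) ⬝ᵥ S.mulVec (Z j) / d - (if i = j then S.trace / d else 0)| ≤
                    (d : ℝ) ^ (-((1 : ℝ) / 2 - 2 / (8 + m))) *
                      Real.log d ^ ((0.51 : ℝ))} := by
  set α : ℝ := 2 / (8 + m) with hα
  have hα4 : 0 < (1 : ℝ) / 2 - α := by
    have : α < 1 / 2 := by
      rw [hα, div_lt_iff₀ (by positivity)]
      linarith
    linarith
  have hev := (eventually_rpow_neg_mul_log_rpow_le_one hα4 0.51).and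
    (eventually_sq_mul_exp_neg_log_rpow_le (b := 256 * C ^ 2) (r := 1.02) (by positivity)
      (by norm_num) (2 / c ^ 2))
  obtain ⟨D, hD⟩ := Filter.eventually_atTop.1 (tendsto_natCast_atTop_atTop.eventually hev)
  refine ⟨max D 1, fun d hd n hn hcd _ ρ hρp _ hsq hmean hvar hbd S _ hS => ?_⟩
  obtain ⟨hδ, hexp⟩ := hD d ((le_max_left _ _).trans hd)
  have hd1 : 1 ≤ d := (le_max_right _ _).trans hd
  have hd0 : (0 : ℝ) < d := by exact_mod_cast hd1
  have hn0 : (0 : ℝ) < n := by exact_mod_cast hn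
  have hlog : 0 ≤ Real.log d := Real.log_natCast_nonneg d
  have : Nonempty (Fin d) := ⟨⟨0, hd1⟩⟩
  set δ : ℝ := (d : ℝ) ^ (-((1 : ℝ) / 2 - α)) * Real.log d ^ (0.51 : ℝ) with hδdef
  have hδ0 : 0 ≤ δ := by positivity
  set P := Measure.pi fun _ : Fin n => Measure.pi fun _ : Fin d => ρ
  set E := Real.exp (-(Real.log d ^ (1.02 : ℝ) / (256 * C ^ 2)))
  have hK : IsBoundedStandardized ρ (C * (d : ℝ) ^ α) := ⟨hsq, hmean, hvar, hbd⟩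
  have hexponent : (d * δ) ^ 2 / (256 * (C * (d : ℝ) ^ α) ^ 2 * Fintype.card (Fin d)) =
      Real.log d ^ (1.02 : ℝ) / (256 * C ^ 2) := by
    have h1 : (Real.log d ^ (0.51 : ℝ)) ^ 2 = Real.log d ^ (1.02 : ℝ) := by
      rw [← Real.rpow_mul_natCast hlog]
      norm_num
    have h2 : (d : ℝ) * ((d : ℝ) ^ (-((1 : ℝ) / 2 - α))) ^ 2 = ((d : ℝ) ^ α) ^ 2 := by
      rw [← Real.rpow_mul_natCast hd0.le, ← Real.rpow_mul_natCast hd0.le]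
      nth_rewrite 1 [← Real.rpow_one (d : ℝ)]
      rw [← Real.rpow_add hd0]
      congr 1
      push_cast
      ring
    have h3 : (d : ℝ) * δ ^ 2 = ((d : ℝ) ^ α) ^ 2 * Real.log d ^ (1.02 : ℝ) := by
      rw [hδdef, mul_pow, h1, ← h2]
      ring
    have h4 : (0 : ℝ) < (d : ℝ) ^ α := by positivity
    rw [Fintype.card_fin, div_eq_div_iff (by positivity) (by positivity)]
    calc ((d : ℝ) * δ) ^ 2 * (256 * C ^ 2) = d * (d * δ ^ 2) * (256 * C ^ 2) := by ring
      _ = _ := by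
        rw [h3]
        ring
  have htail : ∀ i j : Fin n, P {Z | d * δ < |Z i ⬝ᵥ S *ᵥ Z j - if i = j then S.trace else 0|} ≤
      2 * ENNReal.ofReal E := by
    intro i j
    have h := measure_gram_deviation_le (κ := Fin n) hK (isL2Contraction_of_opNorm_le hS) i j
      (t := d * δ) (by positivity) (by simpa using mul_le_of_le_one_right hd0.le hδ)
    rwa [hexponent] at h
  have hcompl : ∀ G : Set (Fin n → Fin d → ℝ),
      Gᶜ ⊆ ⋃ i : Fin n, ⋃ j : Fin n,
        {Z | d * δ < |Z i ⬝ᵥ S *ᵥ Z j - if i = j then S.trace else 0|} →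
      ENNReal.ofReal (1 - 1 / (d : ℝ) ^ 2) ≤ P G := by
    intro G hG
    rw [ENNReal.ofReal_sub _ (by positivity), ENNReal.ofReal_one, tsub_le_iff_right]
    calc (1 : ENNReal) = P Set.univ := measure_univ.symm
      _ ≤ P G + P Gᶜ := measure_univ_le_add_compl G
      _ ≤ P G + ENNReal.ofReal (1 / (d : ℝ) ^ 2) := by
        gcongr
        calc P Gᶜ ≤ ∑ i : Fin n, ∑ j : Fin n,
              P {Z | d * δ < |Z i ⬝ᵥ S *ᵥ Z j - if i = j then S.trace else 0|} :=
              (measure_mono hG).trans <| (measure_iUnion_fintype_le _ _).trans <|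
                Finset.sum_le_sum fun i _ => measure_iUnion_fintype_le _ _
          _ ≤ ∑ _i : Fin n, ∑ _j : Fin n, 2 * ENNReal.ofReal E :=
              Finset.sum_le_sum fun i _ => Finset.sum_le_sum fun j _ => htail i j
          _ = ENNReal.ofReal (n * (n * (2 * E))) := by
              rw [ENNReal.ofReal_mul hn0.le, ENNReal.ofReal_mul hn0.le,
                ENNReal.ofReal_mul zero_le_two]
              simp
          _ ≤ ENNReal.ofReal (1 / (d : ℝ) ^ 2) := by
              refine ENNReal.ofReal_le_ofReal (le_trans ?_ hexp)
              have hnd : (n : ℝ) ≤ d / c := by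
                rw [le_div_iff₀ hc, mul_comm]
                exact (le_div_iff₀ hn0).1 hcd
              calc (n : ℝ) * (n * (2 * E)) ≤ d / c * (d / c * (2 * E)) := by gcongr
                _ = 2 / c ^ 2 * (d : ℝ) ^ 2 * E := by ring
  refine hcompl _ fun Z hZ => ?_
  simp only [Set.mem_compl_iff, Set.mem_ofPred_eq, not_forall, not_le] at hZ
  obtain ⟨i, j, hij⟩ := hZ
  refine Set.mem_iUnion.2 ⟨i, Set.mem_iUnion.2 ⟨j, ?_⟩⟩
  have hscale : Z i ⬝ᵥ S *ᵥ Z j / d - (if i = j then S.trace / d else 0) =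
      (Z i ⬝ᵥ S *ᵥ Z j - if i = j then S.trace else 0) / d := by
    split_ifs <;> ring
  rw [hscale, abs_div, abs_of_pos hd0, lt_div_iff₀ hd0, mul_comm] at hij
  exact hij
end

section
/- Let H be a real Hilbert space, φ_1,…,φ_n ∈ H, and k a positive integer. Let ε_1,…,ε_n be i.i.d. Rademacher random variables. Then E_ε sup_P (1/n) Σ_{i=1}^n ε_i ‖P φ_i‖² ≤ √(k/n) · √( (1/n) Σ_{i=1}^n ‖φ_i‖⁴ ), where the supremum is taken over all orthogonal projections P on H of rank k. -/
open Finset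
open scoped RealInnerProductSpace TensorProduct

universe u

/-- Orthogonality of the Rademacher signs: the second moment of a Rademacher sum. -/
theorem sum_norm_sq_rademacher {E : Type*} [NormedAddCommGroup E] [InnerProductSpace ℝ E]
    (n : ℕ) (v : Fin n → E) :
    ∑ σ : Fin n → Bool, ‖∑ i, (if σ i then (1 : ℝ) else -1) • v i‖ ^ 2
      = 2 ^ n * ∑ i, ‖v i‖ ^ 2 := by
  induction n with
  | zero => simp
  | succ n ih =>
    have ih' := ih (fun i => v i.succ)
    rw [← (Fin.consEquiv (fun _ : Fin (n + 1) => Bool)).sum_comp, Fintype.sum_prod_type]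
    simp only [Fintype.sum_bool, Fin.consEquiv_apply, Fin.sum_univ_succ, Fin.cons_zero,
      Fin.cons_succ, if_true, Bool.false_eq_true, if_false, one_smul, neg_smul]
    rw [← sum_add_distrib]
    have key (w : E) : ‖v 0 + w‖ ^ 2 + ‖-v 0 + w‖ ^ 2 = 2 * ‖v 0‖ ^ 2 + 2 * ‖w‖ ^ 2 := by
      rw [norm_add_sq_real, norm_add_sq_real, inner_neg_left, norm_neg]
      ring
    simp only [key, sum_add_distrib, ← mul_sum, ih']
    simp
    ring

/-- The square of a real inner product is again the kernel of a feature map, namely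
`x ↦ x ⊗ₜ x`. -/
theorem exists_inner_eq_inner_sq (H : Type u) [NormedAddCommGroup H] [InnerProductSpace ℝ H] :
    ∃ (E : Type u) (_ : NormedAddCommGroup E) (_ : InnerProductSpace ℝ E) (τ : H → E),
      ∀ x y, ⟪τ x, τ y⟫ = ⟪x, y⟫ ^ 2 :=
  ⟨H ⊗[ℝ] H, inferInstance, inferInstance, fun x => x ⊗ₜ[ℝ] x, fun x y => by
    rw [TensorProduct.inner_tmul, sq]⟩

/-- A symmetric idempotent of rank `k` with range basis `b` is represented by the vector
`∑ j, τ (b j)` of norm `√k`, so Cauchy–Schwarz applies. -/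
theorem sum_mul_norm_proj_sq_le {ι H E : Type*} [Fintype ι] [NormedAddCommGroup H]
    [InnerProductSpace ℝ H] [NormedAddCommGroup E] [InnerProductSpace ℝ E] (τ : H → E)
    (hτ : ∀ x y, ⟪τ x, τ y⟫ = ⟪x, y⟫ ^ 2) (φ : ι → H) (c : ι → ℝ) {k : ℕ} (hk : 0 < k) (P : H →L[ℝ] H)
    (hP : ∀ u, P (P u) = P u) (hsymm : ∀ u w, ⟪P u, w⟫ = ⟪u, P w⟫)
    (hrank : Module.finrank ℝ (LinearMap.range (P : H →ₗ[ℝ] H)) = k) :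
    ∑ i, c i * ‖P (φ i)‖ ^ 2 ≤ √k * ‖∑ i, c i • τ (φ i)‖ := by
  have : FiniteDimensional ℝ (LinearMap.range (P : H →ₗ[ℝ] H)) :=
    Module.finite_of_finrank_pos (hrank ▸ hk)
  let b := (stdOrthonormalBasis ℝ (LinearMap.range (P : H →ₗ[ℝ] H))).reindex (finCongr hrank)
  have horth : ∀ j l, ⟪(b j : H), (b l : H)⟫ = if j = l then (1 : ℝ) else 0 := fun j l => by
    rw [← Submodule.coe_inner, orthonormal_iff_ite.mp b.orthonormal]
  have hfix : ∀ j, P (b j) = b j := fun j => by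
    obtain ⟨u, hu⟩ := (b j).2
    rw [← hu]
    exact hP u
  have hnorm : ∀ u, ‖P u‖ ^ 2 = ∑ j, ⟪u, (b j : H)⟫ ^ 2 := fun u => by
    have h := b.sum_sq_norm_inner_left ⟨P u, LinearMap.mem_range_self (P : H →ₗ[ℝ] H) u⟩
    simp only [Submodule.coe_inner, Submodule.coe_norm, Real.norm_eq_abs, sq_abs] at h
    rw [← h]
    exact sum_congr rfl fun j _ => by rw [hsymm, hfix]
  have hQ : ‖∑ j, τ (b j)‖ = √k := by
    rw [norm_eq_sqrt_real_inner]
    simp only [sum_inner, inner_sum, hτ, horth]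
    simp
  have hinner : ∑ i, c i * ‖P (φ i)‖ ^ 2
      = ⟪∑ j, τ (b j), ∑ i, c i • τ (φ i)⟫ := by
    rw [inner_sum]
    refine sum_congr rfl fun i _ => ?_
    rw [real_inner_smul_right, sum_inner, hnorm]
    simp only [hτ, real_inner_comm]
  rw [hinner, ← hQ]
  exact real_inner_le_norm _ _

/-- for vectors `φ_1, …, φ_n` in a real Hilbert space `H` and a
positive integer `k`, the Rademacher average of the supremum over rank-`k`
orthogonal projections `P` of `(1/n) Σ_i ε_i ‖P φ_i‖²` is at most
`√(k/n) · √((1/n) Σ_i ‖φ_i‖⁴)`.  The expectation over the i.i.d. Rademacher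
signs is written as the average over all `2^n` sign patterns, and an orthogonal
projection of rank `k` is a self-adjoint idempotent bounded operator whose
range has dimension `k`. -/
theorem stmt_14 (H : Type*) [NormedAddCommGroup H] [InnerProductSpace ℝ H]
    [CompleteSpace H] (n : ℕ) (hn : 0 < n) (φ : Fin n → H) (k : ℕ) (hk : 0 < k) :
    ((2 : ℝ) ^ n)⁻¹ *
      ∑ σ : Fin n → Bool,
        sSup {v : ℝ | ∃ P : H →L[ℝ] H,
          (∀ u, P (P u) = P u) ∧
          (∀ u w, ⟪P u, w⟫ = ⟪u, P w⟫) ∧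
          Module.finrank ℝ (LinearMap.range (P : H →ₗ[ℝ] H)) = k ∧
          v = (n : ℝ)⁻¹ * ∑ i, (if σ i then (1 : ℝ) else -1) * ‖P (φ i)‖ ^ 2}
    ≤ Real.sqrt ((k : ℝ) / n) * Real.sqrt ((n : ℝ)⁻¹ * ∑ i, ‖φ i‖ ^ 4) := by
  obtain ⟨E, _, _, τ, hτ⟩ := exists_inner_eq_inner_sq H
  let T : (Fin n → Bool) → E := fun σ => ∑ i, (if σ i then (1 : ℝ) else -1) • τ (φ i)
  have hn' : (0 : ℝ) < n := Nat.cast_pos.mpr hn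
  have hsecond : ∑ σ, ‖T σ‖ ^ 2 = 2 ^ n * ∑ i, ‖φ i‖ ^ 4 := by
    rw [sum_norm_sq_rademacher]
    congr 1
    refine sum_congr rfl fun i _ => ?_
    rw [← real_inner_self_eq_norm_sq, hτ, real_inner_self_eq_norm_sq]
    ring
  have hmean : ((2 : ℝ) ^ n)⁻¹ * ∑ σ, ‖T σ‖ ≤ √(∑ i, ‖φ i‖ ^ 4) := by
    apply Real.le_sqrt_of_sq_le
    have h := sq_sum_le_card_mul_sum_sq (s := univ) (f := fun σ => ‖T σ‖)
    rw [hsecond, card_univ, Fintype.card_fun, Fintype.card_bool, Fintype.card_fin] at h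
    push_cast at h
    rw [mul_pow, inv_pow, inv_mul_le_iff₀ (by positivity)]
    exact h.trans_eq (by ring)
  have hrhs : √((k : ℝ) / n) * √((n : ℝ)⁻¹ * ∑ i, ‖φ i‖ ^ 4)
      = (n : ℝ)⁻¹ * √k * √(∑ i, ‖φ i‖ ^ 4) := by
    rw [Real.sqrt_div (Nat.cast_nonneg k), Real.sqrt_mul (by positivity), Real.sqrt_inv]
    nth_rewrite 3 [← Real.mul_self_sqrt hn'.le]
    rw [mul_inv]
    ring
  rw [hrhs]
  calc _ ≤ ((2 : ℝ) ^ n)⁻¹ * ∑ σ, (n : ℝ)⁻¹ * √k * ‖T σ‖ := by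
        gcongr with σ _
        refine Real.sSup_le ?_ (by positivity)
        rintro v ⟨P, hP, hsymm, hrank, rfl⟩
        rw [mul_assoc]
        gcongr
        exact sum_mul_norm_proj_sq_le τ hτ φ _ hk P hP hsymm hrank
    _ = (n : ℝ)⁻¹ * √k * (((2 : ℝ) ^ n)⁻¹ * ∑ σ, ‖T σ‖) := by
        rw [← mul_sum]
        ring
    _ ≤ _ := by gcongr
end
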